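/- Let H be a real Hilbert space, let α > 0, γ > 0, ρ > 0, q > 1, set q* = q/(q−1), and let φ be the generalized Huber function φ(x) = α − ρ^{q*}/q* + ρ‖x‖ if ‖x‖ > ρ^{q*/q}, φ(x) = α + ‖x‖^q/q if ‖x‖ ≤ ρ^{q*/q}. Let σ ∈ ℝ and x ∈ H. Suppose ‖x‖^{q*} > q* γ^{q*} (α − σ/γ) and ‖x‖ < γρ^{q*−1}(σ/γ + ρ^{2−q*} + ρ^{q*}/q* − α). If x ≠ 0, the equation γ t^{2q*−1} + q*(σ − γα) t^{q*−1} + γ q* t − q*‖x‖ = 0 has a unique solution t in (0,∞); set p = t x/‖x‖ if x ≠ 0 and p = 0 if x = 0. Then prox_{γφ̃}(σ,x) = (σ + γ(t^{q*}/q* − α), x − γp) if q* γ^{q*−1} σ + ‖x‖^{q*} > q* γ^{q*} α, and prox_{γφ̃}(σ,x) = (0,0) if q* γ^{q*−1} σ + ‖x‖^{q*} ≤ q* γ^{q*} α. -/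

import Mathlib

noncomputable section

/-- The perspective of a (finite-valued) function `φ : H → ℝ`: it equals
`σ φ(x/σ)` for `σ > 0`, the recession function
`(rec φ)(x) = sup_y (φ(x+y) − φ(y))` for `σ = 0`, and `+∞` for `σ < 0`. -/
def perspR {H : Type*} [NormedAddCommGroup H] [NormedSpace ℝ H]
    (φ : H → ℝ) (p : ℝ × H) : EReal :=
  if 0 < p.1 then ((p.1 * φ (p.1⁻¹ • p.2) : ℝ) : EReal)
  else if p.1 = 0 then ⨆ y : H, ((φ (p.2 + y) - φ y : ℝ) : EReal)
  else ⊤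

/-- `p` is the proximal point of `ψ : ℝ × H → (−∞,∞]` at `z`, i.e. `p` minimizes
`y ↦ ψ(y) + ½‖z − y‖²` (the squared norm on `ℝ × H` being the Hilbert one). -/
def IsProx {H : Type*} [NormedAddCommGroup H]
    (ψ : ℝ × H → EReal) (z p : ℝ × H) : Prop :=
  ∀ y : ℝ × H,
    ψ p + ((((z.1 - p.1) ^ 2 + ‖z.2 - p.2‖ ^ 2) / 2 : ℝ) : EReal) ≤
      ψ y + ((((z.1 - y.1) ^ 2 + ‖z.2 - y.2‖ ^ 2) / 2 : ℝ) : EReal)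

open scoped RealInnerProductSpace in
theorem isProx_iff_of_subgrad {H : Type*} [NormedAddCommGroup H] [InnerProductSpace ℝ H]
    (ψ : ℝ × H → EReal) (z P : ℝ × H) (c : ℝ) (u : H)
    (hle : ∀ w : ℝ × H, ((c * w.1 + inner ℝ u w.2 : ℝ) : EReal) ≤ ψ w)
    (heq : ψ P = ((c * P.1 + inner ℝ u P.2 : ℝ) : EReal))
    (hc : z.1 - P.1 = c) (hu : z.2 - P.2 = u) (p : ℝ × H) :
    IsProx ψ z p ↔ p = P := by
  have key : ∀ w : ℝ × H, (c * w.1 + inner ℝ u w.2)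
      + ((z.1 - w.1) ^ 2 + ‖z.2 - w.2‖ ^ 2) / 2
      = (c * P.1 + inner ℝ u P.2) + ((z.1 - P.1) ^ 2 + ‖z.2 - P.2‖ ^ 2) / 2
        + ((w.1 - P.1) ^ 2 + ‖w.2 - P.2‖ ^ 2) / 2 := by
    intro w
    have e : z.2 - w.2 = u - (w.2 - P.2) := by rw [← hu]; abel
    have e1 : z.1 - w.1 = c - (w.1 - P.1) := by rw [← hc]; abel
    rw [e, e1, hc, hu, norm_sub_sq_real, inner_sub_right]
    ring
  constructor
  · intro h
    have h3 := h P
    have h4 := (add_le_add_left (hle p) _).trans h3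
    rw [heq, ← EReal.coe_add, ← EReal.coe_add, EReal.coe_le_coe_iff, key p] at h4
    have h5 : (p.1 - P.1) ^ 2 = 0 := by nlinarith [sq_nonneg (p.1 - P.1), sq_nonneg ‖p.2 - P.2‖]
    have h6 : ‖p.2 - P.2‖ ^ 2 = 0 := by nlinarith [sq_nonneg (p.1 - P.1), sq_nonneg ‖p.2 - P.2‖]
    refine Prod.ext ?_ ?_
    · exact sub_eq_zero.mp (pow_eq_zero_iff (two_ne_zero) |>.mp h5)
    · exact sub_eq_zero.mp (norm_eq_zero.mp (pow_eq_zero_iff (two_ne_zero) |>.mp h6))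
  · rintro rfl y
    refine le_trans ?_ (add_le_add_left (hle y) _)
    rw [heq, ← EReal.coe_add, ← EReal.coe_add, EReal.coe_le_coe_iff, key y]
    nlinarith [sq_nonneg (y.1 - p.1), sq_nonneg ‖y.2 - p.2‖]

theorem huberF_lt (α γ σ qs a b : ℝ) (hγ : 0 < γ) (hqs : 1 < qs) (ha : 0 ≤ a) (hab : a < b)
    (hb : 0 ≤ σ + γ * (b ^ qs / qs - α)) :
    a ^ (qs - 1) * (σ + γ * (a ^ qs / qs - α)) + γ * a
      < b ^ (qs - 1) * (σ + γ * (b ^ qs / qs - α)) + γ * b := by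
  have h1 : γ * a < γ * b := by gcongr
  have h2 : a ^ (qs - 1) ≤ b ^ (qs - 1) := Real.rpow_le_rpow ha hab.le (by linarith)
  have h3 : a ^ qs ≤ b ^ qs := Real.rpow_le_rpow ha hab.le (by linarith)
  have h4 : σ + γ * (a ^ qs / qs - α) ≤ σ + γ * (b ^ qs / qs - α) := by gcongr
  have h5 : 0 ≤ a ^ (qs - 1) := Real.rpow_nonneg ha _
  have h7 : a ^ (qs - 1) * (σ + γ * (a ^ qs / qs - α))
      ≤ a ^ (qs - 1) * (σ + γ * (b ^ qs / qs - α)) := by gcongr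
  have h8 : a ^ (qs - 1) * (σ + γ * (b ^ qs / qs - α))
      ≤ b ^ (qs - 1) * (σ + γ * (b ^ qs / qs - α)) := by gcongr
  linarith

/-- the equation, rewritten -/
theorem huber_eqn (α γ σ qs t n : ℝ) (hqs : 1 < qs) (ht : 0 < t) :
    γ * t ^ (2 * qs - 1) + qs * (σ - γ * α) * t ^ (qs - 1) + γ * qs * t - qs * n = 0 ↔
    t ^ (qs - 1) * (σ + γ * (t ^ qs / qs - α)) + γ * t = n := by
  have e : t ^ (2 * qs - 1) = t ^ (qs - 1) * t ^ qs := by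
    rw [← Real.rpow_add ht]; ring_nf
  have hq0 : qs ≠ 0 := by linarith
  have e2 : γ * t ^ (2 * qs - 1) + qs * (σ - γ * α) * t ^ (qs - 1) + γ * qs * t - qs * n
      = qs * (t ^ (qs - 1) * (σ + γ * (t ^ qs / qs - α)) + γ * t - n) := by
    rw [e]; field_simp; ring
  rw [e2, mul_eq_zero, sub_eq_zero]
  simp [hq0]

theorem huber_root_pos (α γ σ qs t n : ℝ) (hγ : 0 < γ) (hqs : 1 < qs) (ht : 0 ≤ t) (hn : 0 ≤ n)
    (h1 : qs * γ ^ qs * (α - σ / γ) < n ^ qs)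
    (h : n ≤ γ * t ∨ t ^ (qs - 1) * (σ + γ * (t ^ qs / qs - α)) + γ * t = n) :
    0 < σ + γ * (t ^ qs / qs - α) := by
  by_contra hs
  push Not at hs
  have h5 : 0 ≤ t ^ (qs - 1) := Real.rpow_nonneg ht _
  have h6 : n ≤ γ * t := by
    rcases h with h | h
    · exact h
    · nlinarith
  have h7 : n ^ qs ≤ γ ^ qs * t ^ qs := by
    rw [← Real.mul_rpow hγ.le ht]
    exact Real.rpow_le_rpow hn h6 (by linarith)
  have h8 : 0 < γ ^ qs := Real.rpow_pos_of_pos hγ _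
  have h9 : γ ^ qs * (qs * (α - σ / γ)) < γ ^ qs * t ^ qs := by linarith
  have h10 := lt_of_mul_lt_mul_left h9 h8.le
  have h11 : α - σ / γ < t ^ qs / qs := by
    rw [lt_div_iff₀ (by linarith)]; linarith
  have h12 : γ * (α - σ / γ) < γ * (t ^ qs / qs) := by gcongr
  have h13 : γ * (α - σ / γ) = γ * α - σ := by field_simp
  linarith

theorem huber_exists (α γ σ qs n : ℝ) (hγ : 0 < γ) (hqs : 1 < qs) (hn : 0 < n)
    (h1 : qs * γ ^ qs * (α - σ / γ) < n ^ qs) :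
    ∃ t, 0 < t ∧ t ^ (qs - 1) * (σ + γ * (t ^ qs / qs - α)) + γ * t = n := by
  have hcont : ContinuousOn (fun t : ℝ => t ^ (qs - 1) * (σ + γ * (t ^ qs / qs - α)) + γ * t)
      (Set.Icc 0 (n / γ)) := by
    apply Continuous.continuousOn
    have c1 := Real.continuous_rpow_const (q := qs - 1) (by linarith)
    have c2 := Real.continuous_rpow_const (q := qs) (by linarith)
    fun_prop
  have hp : 0 ≤ n / γ := by positivity
  have hsp := huber_root_pos α γ σ qs (n / γ) n hγ hqs hp hn.le h1
    (Or.inl (by field_simp; exact le_rfl))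
  have h0 : (0 : ℝ) ^ (qs - 1) = 0 := Real.zero_rpow (by linarith)
  obtain ⟨t, ht, hte⟩ := intermediate_value_Icc hp hcont (show n ∈ Set.Icc _ _ from by
    constructor
    · simp only [h0]; linarith
    · have : γ * (n / γ) = n := by field_simp
      simp only [this]
      have := Real.rpow_nonneg hp (qs - 1)
      nlinarith)
  refine ⟨t, lt_of_le_of_ne ht.1 ?_, hte⟩
  rintro rfl
  simp only [h0] at hte
  linarith

theorem huber_lower {H : Type*} [NormedAddCommGroup H] [InnerProductSpace ℝ H]
    (α ρ q qs t : ℝ) (hρ : 0 < ρ) (hq : q.HolderConjugate qs)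
    (ht : 0 ≤ t) (htρ : t ≤ ρ) (φ : H → ℝ)
    (hφ : ∀ v : H, φ v =
      if ‖v‖ ≤ ρ ^ (qs / q) then α + ‖v‖ ^ q / q
      else α - ρ ^ qs / qs + ρ * ‖v‖) (u : H) (hu : ‖u‖ ≤ t) (v : H) :
    α - t ^ qs / qs + inner ℝ u v ≤ φ v := by
  have h1 : inner ℝ u v ≤ t * ‖v‖ := (real_inner_le_norm u v).trans (by gcongr)
  rw [hφ]
  split_ifs with h
  · have := Real.young_inequality_of_nonneg (norm_nonneg v) ht hq
    linarith
  · push Not at h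
    have hr : 0 ≤ ρ ^ (qs / q) := Real.rpow_nonneg hρ.le _
    have y := Real.young_inequality_of_nonneg hr ht hq
    have e1 : (ρ ^ (qs / q)) ^ q = ρ ^ qs := by
      rw [← Real.rpow_mul hρ.le, div_mul_cancel₀ _ hq.pos.ne']
    have e2 : ρ ^ (qs / q) * ρ = ρ ^ qs := by
      have : qs / q = qs - 1 := hq.symm.div_conj_eq_sub_one
      rw [this, ← Real.rpow_add_one hρ.ne']; ring_nf
    have e3 : ρ ^ qs / q + ρ ^ qs / qs = ρ ^ qs := by
      have := hq.inv_add_inv_eq_one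
      rw [div_eq_mul_inv, div_eq_mul_inv, ← mul_add, this, mul_one]
    rw [e1] at y
    nlinarith [mul_le_mul_of_nonneg_right h.le (sub_nonneg.mpr htρ)]

theorem huber_persp_lower {H : Type*} [NormedAddCommGroup H] [InnerProductSpace ℝ H]
    (α ρ q qs t : ℝ) (hρ : 0 < ρ) (hq : q.HolderConjugate qs)
    (ht : 0 ≤ t) (htρ : t ≤ ρ) (φ : H → ℝ)
    (hφ : ∀ v : H, φ v =
      if ‖v‖ ≤ ρ ^ (qs / q) then α + ‖v‖ ^ q / q
      else α - ρ ^ qs / qs + ρ * ‖v‖) (u : H) (hu : ‖u‖ ≤ t) (w : ℝ × H) :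
    (((α - t ^ qs / qs) * w.1 + inner ℝ u w.2 : ℝ) : EReal) ≤ perspR φ w := by
  obtain ⟨τ, w⟩ := w
  unfold perspR
  dsimp only
  split_ifs with h h'
  · rw [EReal.coe_le_coe_iff]
    have := huber_lower α ρ q qs t hρ hq ht htρ φ hφ u hu (τ⁻¹ • w)
    rw [inner_smul_right] at this
    have h2 := mul_le_mul_of_nonneg_left this h.le
    have h3 : τ * (α - t ^ qs / qs + τ⁻¹ * inner ℝ u w)
      = (α - t ^ qs / qs) * τ + inner ℝ u w := by field_simp
    linarith
  · subst h'
    by_cases hw : w = 0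
    · subst hw
      refine le_trans ?_ (le_iSup _ (0 : H))
      simp
    · have hn : 0 < ‖w‖ := norm_pos_iff.mpr hw
      have hr : 0 ≤ ρ ^ (qs / q) := Real.rpow_nonneg hρ.le _
      set c : ℝ := ρ ^ (qs / q) / ‖w‖ + 1 with hc
      have hc0 : 0 < c := by positivity
      have hcw : ρ ^ (qs / q) < c * ‖w‖ := by
        rw [hc, add_mul, div_mul_cancel₀ _ hn.ne']; linarith
      refine le_trans ?_ (le_iSup _ (c • w))
      rw [EReal.coe_le_coe_iff]
      have e : w + c • w = (1 + c) • w := by rw [add_smul 1 c w, one_smul]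
      rw [e, hφ, hφ, norm_smul, norm_smul, Real.norm_of_nonneg hc0.le,
        Real.norm_of_nonneg (by linarith), if_neg (by linarith), if_neg (by linarith)]
      have h1 : inner ℝ u w ≤ ρ * ‖w‖ :=
        (real_inner_le_norm u w).trans (by gcongr; linarith)
      linarith
  · exact le_top

/-- Prox of the perspective of the generalized Huber function: quadratic regime. -/
theorem prox_generalized_huber_quadratic_regime
    {H : Type*} [NormedAddCommGroup H] [InnerProductSpace ℝ H] [CompleteSpace H]
    (α γ ρ q : ℝ) (hα : 0 < α) (hγ : 0 < γ) (hρ : 0 < ρ) (hq : 1 < q)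
    (qs : ℝ) (hqs : qs = q / (q - 1))
    (φ : H → ℝ)
    (hφ : ∀ v : H, φ v =
      if ‖v‖ ≤ ρ ^ (qs / q) then α + ‖v‖ ^ q / q
      else α - ρ ^ qs / qs + ρ * ‖v‖)
    (σ : ℝ) (x : H)
    (h1 : qs * γ ^ qs * (α - σ / γ) < ‖x‖ ^ qs)
    (h2 : ‖x‖ < γ * ρ ^ (qs - 1) * (σ / γ + ρ ^ (2 - qs) + ρ ^ qs / qs - α)) :
    (x ≠ 0 → ∃! t : ℝ, 0 < t ∧
        γ * t ^ (2 * qs - 1) + qs * (σ - γ * α) * t ^ (qs - 1)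
          + γ * qs * t - qs * ‖x‖ = 0) ∧
      ∀ t : ℝ, ∀ pdir : H,
        ((x ≠ 0 ∧ 0 < t ∧
            γ * t ^ (2 * qs - 1) + qs * (σ - γ * α) * t ^ (qs - 1)
              + γ * qs * t - qs * ‖x‖ = 0 ∧ pdir = (t / ‖x‖) • x) ∨
          (x = 0 ∧ t = 0 ∧ pdir = 0)) →
        (qs * γ ^ (qs - 1) * σ + ‖x‖ ^ qs > qs * γ ^ qs * α →
          ∀ p : ℝ × H,
            IsProx (fun w => (γ : EReal) * perspR φ w) (σ, x) p ↔
              p = (σ + γ * (t ^ qs / qs - α), x - γ • pdir)) ∧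
        (qs * γ ^ (qs - 1) * σ + ‖x‖ ^ qs ≤ qs * γ ^ qs * α →
          ∀ p : ℝ × H,
            IsProx (fun w => (γ : EReal) * perspR φ w) (σ, x) p ↔ p = (0, 0)) := by
  have hq0 : 0 < q - 1 := by linarith
  have hconj : q.HolderConjugate qs := by
    rw [hqs]; exact Real.HolderConjugate.conjExponent hq
  have hqs1 : 1 < qs := hconj.symm.lt
  have hN := norm_nonneg x
  refine ⟨?_, ?_⟩
  · intro hx
    have hn : 0 < ‖x‖ := norm_pos_iff.mpr hx
    obtain ⟨t, ht, hte⟩ := huber_exists α γ σ qs ‖x‖ hγ hqs1 hn h1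
    refine ⟨t, ⟨ht, (huber_eqn α γ σ qs t ‖x‖ hqs1 ht).mpr hte⟩, ?_⟩
    rintro s ⟨hs, hse⟩
    rw [huber_eqn α γ σ qs s ‖x‖ hqs1 hs] at hse
    have p1 := huber_root_pos α γ σ qs t ‖x‖ hγ hqs1 ht.le hN h1 (Or.inr hte)
    have p2 := huber_root_pos α γ σ qs s ‖x‖ hγ hqs1 hs.le hN h1 (Or.inr hse)
    rcases lt_trichotomy s t with h | h | h
    · have := huberF_lt α γ σ qs s t hγ hqs1 hs.le h p1.le
      linarith
    · exact h
    · have := huberF_lt α γ σ qs t s hγ hqs1 ht.le h p2.le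
      linarith
  intro t pdir hcase
  refine ⟨fun _ p => ?_, fun h => ?_⟩
  swap
  · exfalso
    have e : γ ^ qs = γ ^ (qs - 1) * γ := by
      rw [← Real.rpow_add_one hγ.ne']; ring_nf
    have : qs * γ ^ qs * (α - σ / γ) = qs * γ ^ qs * α - qs * γ ^ (qs - 1) * σ := by
      rw [mul_sub]; congr 1; rw [e]; field_simp
    linarith
  have z1 : (0 : ℝ) ^ (qs - 1) = 0 := Real.zero_rpow (by linarith)
  have z2 : (0 : ℝ) ^ qs = 0 := Real.zero_rpow (by linarith)
  -- facts common to both cases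
  obtain ⟨ht, hte, hpn, hpi, hvn⟩ : 0 ≤ t ∧
      t ^ (qs - 1) * (σ + γ * (t ^ qs / qs - α)) + γ * t = ‖x‖ ∧ ‖pdir‖ ≤ t ∧
      inner ℝ pdir (x - γ • pdir) = t * (‖x‖ - γ * t) ∧ ‖x - γ • pdir‖ = |‖x‖ - γ * t| := by
    rcases hcase with ⟨hx, ht, he, rfl⟩ | ⟨rfl, rfl, rfl⟩
    · have hn : 0 < ‖x‖ := norm_pos_iff.mpr hx
      have e : x - γ • (t / ‖x‖) • x = ((‖x‖ - γ * t) / ‖x‖) • x := by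
        rw [smul_smul, sub_div, sub_smul, div_self hn.ne', one_smul, mul_div_assoc]
      refine ⟨ht.le, (huber_eqn α γ σ qs t ‖x‖ hqs1 ht).mp he, ?_, ?_, ?_⟩
      · rw [norm_smul, Real.norm_of_nonneg (by positivity), div_mul_cancel₀ _ hn.ne']
      · rw [e, inner_smul_left, inner_smul_right, real_inner_self_eq_norm_sq]
        simp only [conj_trivial]
        field_simp
      · rw [e, norm_smul, norm_div, norm_norm, div_mul_cancel₀ _ hn.ne', Real.norm_eq_abs]
    · simp [z1]
  have hs := huber_root_pos α γ σ qs t ‖x‖ hγ hqs1 ht hN h1 (Or.inr hte)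
  have hFρ : γ * ρ ^ (qs - 1) * (σ / γ + ρ ^ (2 - qs) + ρ ^ qs / qs - α)
      = ρ ^ (qs - 1) * (σ + γ * (ρ ^ qs / qs - α)) + γ * ρ := by
    have e : ρ ^ (qs - 1) * ρ ^ (2 - qs) = ρ := by
      rw [← Real.rpow_add hρ]; ring_nf; exact Real.rpow_one ρ
    have e2 : γ * (σ / γ) = σ := by field_simp
    linear_combination γ * e + ρ ^ (qs - 1) * e2
  rw [hFρ] at h2
  have htρ : t ≤ ρ := by
    by_contra hc
    push Not at hc
    have := huberF_lt α γ σ qs ρ t hγ hqs1 hρ.le hc hs.le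
    linarith
  set s : ℝ := σ + γ * (t ^ qs / qs - α) with hsdef
  have htt : t ^ (qs - 1) * t = t ^ qs := by
    have := Real.rpow_add_one' ht (y := qs - 1) (by linarith)
    rw [← this]; ring_nf
  have ht1 : 0 ≤ t ^ (qs - 1) := Real.rpow_nonneg ht _
  have hxs : ‖x‖ - γ * t = t ^ (qs - 1) * s := by linarith
  have hdiv : qs / q = qs - 1 := hconj.symm.div_conj_eq_sub_one
  apply isProx_iff_of_subgrad _ _ _ (γ * (α - t ^ qs / qs)) (γ • pdir)
  · intro w
    have := huber_persp_lower α ρ q qs t hρ hconj ht htρ φ hφ pdir hpn w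
    have h3 := mul_le_mul_of_nonneg_left this (show (0 : EReal) ≤ (γ : EReal) by
      exact_mod_cast hγ.le)
    rw [← EReal.coe_mul] at h3
    convert h3 using 2
    rw [inner_smul_left]; simp only [conj_trivial]; ring
  · have hvn' : ‖s⁻¹ • (x - γ • pdir)‖ = t ^ (qs - 1) := by
      rw [norm_smul, hvn, hxs, abs_of_nonneg (by positivity), norm_inv, Real.norm_of_nonneg hs.le]
      field_simp
    have hpw : (t ^ (qs - 1)) ^ q = t ^ qs := by
      rw [← Real.rpow_mul ht, ← hdiv, div_mul_cancel₀ _ hconj.pos.ne']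
    have hφv : φ (s⁻¹ • (x - γ • pdir)) = α + t ^ qs / q := by
      rw [hφ, hvn', hdiv, if_pos (Real.rpow_le_rpow ht htρ (by linarith)), hpw]
    unfold perspR
    dsimp only
    rw [if_pos hs, hφv, ← EReal.coe_mul, inner_smul_left, hpi, hxs]
    simp only [conj_trivial]
    congr 1
    have e3 : t ^ qs / q + t ^ qs / qs = t ^ qs := by
      have := hconj.inv_add_inv_eq_one
      rw [div_eq_mul_inv, div_eq_mul_inv, ← mul_add, this, mul_one]
    linear_combination γ * s * e3 - γ * s * htt
  · simp only [hsdef]; ring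
  · simp
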